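/- The Weierstrass ℘-function satisfies ∂_τ℘'(z,τ) + ζ₁(z,τ)·℘''(z,τ) = (2πi)^{-1}·3·(℘(z,τ) + (2πi)²·E₂(q)/12)·℘'(z,τ). -/

import Mathlib

noncomputable section
open Complex

/-- `2πi` as a complex number. -/
def i2pi : ℂ := 2 * (Real.pi : ℂ) * Complex.I

/-- membership in the lattice `ℤ + ℤτ`. -/
def lat (τ z : ℂ) : Prop := ∃ m n : ℤ, z = (m : ℂ) + (n : ℂ) * τ

/-- the lattice point `m + nτ`. -/
def latPt (τ : ℂ) (p : ℤ × ℤ) : ℂ := (p.1 : ℂ) + (p.2 : ℂ) * τ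

/-- The Weierstrass zeta function of the lattice `ℤ + ℤτ`. -/
def wzeta (τ z : ℂ) : ℂ :=
  1 / z + ∑' p : {p : ℤ × ℤ // p ≠ 0},
    (1 / (z - latPt τ p) + 1 / latPt τ p + z / (latPt τ p) ^ 2)

/-- The Weierstrass ℘-function, `℘ = -∂_z ζ`. -/
def wp (τ z : ℂ) : ℂ := - deriv (wzeta τ) z

/-- The quasi-period `η₁(τ) = ζ(z+1,τ) - ζ(z,τ)` (evaluated at `z = -1/2`). -/
def eta1 (τ : ℂ) : ℂ := wzeta τ (1 / 2) - wzeta τ (-(1 / 2))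

/-- The quasi-period `η₂(τ) = ζ(z+τ,τ) - ζ(z,τ)` (evaluated at `z = -τ/2`). -/
def eta2 (τ : ℂ) : ℂ := wzeta τ (τ / 2) - wzeta τ (-(τ / 2))

/-- `ζ₁(z,τ) = (-2πi)⁻¹ (ζ(z,τ) - η₁(τ) z)`. -/
def zeta1 (τ z : ℂ) : ℂ := (-i2pi)⁻¹ * (wzeta τ z - eta1 τ * z)

/-- Normalized Eisenstein series of weight 2. -/
def E2 (q : ℂ) : ℂ := 1 - 24 * ∑' n : ℕ+, ((n : ℕ) : ℂ) * q ^ (n : ℕ) / (1 - q ^ (n : ℕ))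

/-- Normalized Eisenstein series of weight 4. -/
def E4 (q : ℂ) : ℂ := 1 + 240 * ∑' n : ℕ+, ((n : ℕ) : ℂ) ^ 3 * q ^ (n : ℕ) / (1 - q ^ (n : ℕ))

/-- Normalized Eisenstein series of weight 6. -/
def E6 (q : ℂ) : ℂ := 1 - 504 * ∑' n : ℕ+, ((n : ℕ) : ℂ) ^ 5 * q ^ (n : ℕ) / (1 - q ^ (n : ℕ))

/-- `g₂(τ) = (2πi)⁴ E₄(q)/12`. -/
def g2 (τ : ℂ) : ℂ := i2pi ^ 4 * E4 (Complex.exp (i2pi * τ)) / 12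

/-- `g₃(τ) = -(2πi)⁶ E₆(q)/216`. -/
def g3 (τ : ℂ) : ℂ := -(i2pi ^ 6) * E6 (Complex.exp (i2pi * τ)) / 216

section

open Filter Topology

/-- the size `1 + |m| + |n|` of a lattice index. -/
def hNrm (p : ℤ × ℤ) : ℝ := 1 + |(p.1 : ℝ)| + |(p.2 : ℝ)|

lemma hNrm_one_le (p : ℤ × ℤ) : 1 ≤ hNrm p := by
  unfold hNrm
  have := abs_nonneg (p.1 : ℝ)
  have := abs_nonneg (p.2 : ℝ)
  linarith

lemma hNrm_pos (p : ℤ × ℤ) : 0 < hNrm p := lt_of_lt_of_le one_pos (hNrm_one_le p)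

lemma summable_hNrm : Summable (fun p : ℤ × ℤ => ((hNrm p) ^ 3)⁻¹) := by
  have h := EisensteinSeries.summable_one_div_norm_rpow (k := 3) (by norm_num)
  rw [← (finTwoArrowEquiv ℤ).symm.summable_iff] at h
  refine Summable.of_norm_bounded_eventually h ?_
  rw [Filter.eventually_cofinite]
  refine (Set.finite_singleton (0 : ℤ × ℤ)).subset ?_
  intro p hp
  by_contra hne
  apply hp
  have hne' : p ≠ 0 := hne
  have hv : (![p.1, p.2] : Fin 2 → ℤ) ≠ 0 := by
    intro h0
    apply hne'
    have h1 := congrFun h0 0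
    have h2 := congrFun h0 1
    simp at h1 h2
    exact Prod.ext h1 h2
  have hpos : 0 < ‖(![p.1, p.2] : Fin 2 → ℤ)‖ := norm_pos_iff.mpr hv
  have hle : ‖(![p.1, p.2] : Fin 2 → ℤ)‖ ≤ hNrm p := by
    rw [pi_norm_le_iff_of_nonneg (hNrm_pos p).le]
    have := abs_nonneg (p.1 : ℝ)
    have := abs_nonneg (p.2 : ℝ)
    intro i
    fin_cases i
    · simp [hNrm, Int.norm_eq_abs]; linarith
    · simp [hNrm, Int.norm_eq_abs]; linarith
  have h3 : (3 : ℝ) = ((3 : ℕ) : ℝ) := by norm_num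
  simp only [Function.comp_apply, finTwoArrowEquiv_symm_apply]
  rw [Real.rpow_neg hpos.le, h3, Real.rpow_natCast, Real.norm_of_nonneg (by have := hNrm_pos p; positivity)]
  gcongr

lemma latPt_lower (τ : ℂ) (hτ : 0 < τ.im) : ∃ c > 0, ∀ p : ℤ × ℤ,
    c * (|(p.1 : ℝ)| + |(p.2 : ℝ)|) ≤ ‖latPt τ p‖ := by
  set A := 1 + ‖τ‖ / τ.im + 1 / τ.im with hA
  have hApos : 0 < A := by positivity
  refine ⟨A⁻¹, by positivity, fun p => ?_⟩
  have h1 : |(p.2 : ℝ)| * τ.im ≤ ‖latPt τ p‖ := by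
    have := Complex.abs_im_le_norm (latPt τ p)
    simpa [latPt, abs_mul, abs_of_pos hτ] using this
  have h2 : |(p.1 : ℝ)| ≤ ‖latPt τ p‖ + |(p.2 : ℝ)| * ‖τ‖ := by
    have : (p.1 : ℂ) = latPt τ p - p.2 * τ := by simp [latPt]
    have h := norm_sub_le (latPt τ p) (p.2 * τ)
    rw [← this] at h
    simpa [Complex.norm_intCast] using h
  have h3 : |(p.2 : ℝ)| ≤ ‖latPt τ p‖ / τ.im := by rwa [le_div_iff₀ hτ]
  rw [inv_mul_le_iff₀ hApos]
  have h4 : |(p.2 : ℝ)| * ‖τ‖ ≤ ‖latPt τ p‖ / τ.im * ‖τ‖ := by gcongr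
  calc _ ≤ ‖latPt τ p‖ + ‖latPt τ p‖ / τ.im * ‖τ‖ + ‖latPt τ p‖ / τ.im := by linarith
    _ = A * ‖latPt τ p‖ := by rw [hA]; field_simp

/-- uniform lower bound away from lattice points -/
lemma key_lower (τ : ℂ) (hτ : 0 < τ.im) (z₀ : ℂ) (S : Set (ℤ × ℤ))
    (hS : ∀ p ∈ S, z₀ - latPt τ p ≠ 0) : ∃ c > 0, ∀ z t : ℂ, ‖z - z₀‖ < c → ‖t - τ‖ < c →
      ∀ p ∈ S, c * hNrm p ≤ ‖z - latPt t p‖ := by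
  obtain ⟨c0, hc0, h0⟩ := latPt_lower τ hτ
  -- pointwise bound
  have hpt : ∃ c > 0, ∀ p ∈ S, c * hNrm p ≤ ‖z₀ - latPt τ p‖ := by
    set M : ℝ := (2 * (‖z₀‖ + c0)) / c0 + 1 with hM
    have hfin : Set.Finite {p : ℤ × ℤ | hNrm p ≤ M} := by
      have hs : Set.Finite (Set.Icc (-⌈M⌉) ⌈M⌉ ×ˢ Set.Icc (-⌈M⌉) ⌈M⌉ : Set (ℤ × ℤ)) :=
        (Set.finite_Icc _ _).prod (Set.finite_Icc _ _)
      refine hs.subset ?_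
      intro p hp
      have hp' : 1 + |(p.1 : ℝ)| + |(p.2 : ℝ)| ≤ M := hp
      have a1 := abs_nonneg (p.1 : ℝ)
      have a2 := abs_nonneg (p.2 : ℝ)
      have hc := Int.le_ceil M
      have b1 : |(p.1 : ℝ)| ≤ (⌈M⌉ : ℝ) := by linarith
      have b2 : |(p.2 : ℝ)| ≤ (⌈M⌉ : ℝ) := by linarith
      rw [abs_le] at b1 b2
      refine ⟨⟨?_, ?_⟩, ⟨?_, ?_⟩⟩
      · exact_mod_cast b1.1
      · exact_mod_cast b1.2
      · exact_mod_cast b2.1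
      · exact_mod_cast b2.2
    have hfin2 : ∃ d > 0, ∀ p ∈ S, hNrm p ≤ M → d * hNrm p ≤ ‖z₀ - latPt τ p‖ := by
      have hf3 : Set.Finite ({p : ℤ × ℤ | hNrm p ≤ M} ∩ S) := hfin.inter_of_left S
      by_cases hne : ({p : ℤ × ℤ | hNrm p ≤ M} ∩ S).Nonempty
      · obtain ⟨p0, hp0, hmin⟩ := Set.exists_min_image _ (fun p => ‖z₀ - latPt τ p‖ / hNrm p) hf3 hne
        refine ⟨‖z₀ - latPt τ p0‖ / hNrm p0,
          div_pos (norm_pos_iff.mpr (hS p0 hp0.2)) (hNrm_pos p0), fun p hp hpM => ?_⟩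
        have := hmin p ⟨hpM, hp⟩
        rwa [le_div_iff₀ (hNrm_pos p)] at this
      · refine ⟨1, one_pos, fun p hp hpM => ?_⟩
        exact absurd ⟨p, hpM, hp⟩ hne
    obtain ⟨d, hd, hd2⟩ := hfin2
    refine ⟨min d (c0 / 2), by positivity, fun p hp => ?_⟩
    by_cases hpM : hNrm p ≤ M
    · refine le_trans ?_ (hd2 p hp hpM)
      have := (hNrm_pos p).le
      gcongr
      exact min_le_left _ _
    · have h1 : min d (c0 / 2) * hNrm p ≤ c0 / 2 * hNrm p := by
        have := (hNrm_pos p).le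
        gcongr
        exact min_le_right _ _
      refine h1.trans ?_
      have h2 := h0 p
      have h3 : ‖latPt τ p‖ - ‖z₀‖ ≤ ‖z₀ - latPt τ p‖ := by
        rw [norm_sub_rev]; exact norm_sub_norm_le _ _
      have h4 : 2 * (‖z₀‖ + c0) ≤ hNrm p * c0 := by
        have : (2 * (‖z₀‖ + c0)) / c0 ≤ hNrm p := by linarith
        rwa [div_le_iff₀ hc0] at this
      have h5 : |(p.1 : ℝ)| + |(p.2 : ℝ)| = hNrm p - 1 := by unfold hNrm; ring
      rw [h5] at h2
      nlinarith
  obtain ⟨c, hc, hcp⟩ := hpt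
  refine ⟨c / 2, by positivity, fun z t hz ht p hp => ?_⟩
  have h1 := hcp p hp
  have e : z₀ - latPt τ p = (z - latPt t p) - (z - z₀) + p.2 * (t - τ) := by
    simp [latPt]; ring
  have h2 : ‖z₀ - latPt τ p‖ ≤ ‖z - latPt t p‖ + ‖z - z₀‖ + |(p.2 : ℝ)| * ‖t - τ‖ := by
    rw [e]
    refine (norm_add_le _ _).trans ?_
    have := norm_sub_le (z - latPt t p) (z - z₀)
    have e2 : ‖(p.2 : ℂ) * (t - τ)‖ = |(p.2 : ℝ)| * ‖t - τ‖ := by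
      rw [norm_mul, Complex.norm_intCast]
    rw [e2]; linarith
  have h3 : |(p.2 : ℝ)| * ‖t - τ‖ ≤ |(p.2 : ℝ)| * (c / 2) := by gcongr
  have h4 : |(p.2 : ℝ)| ≤ hNrm p - 1 := by
    unfold hNrm; have := abs_nonneg (p.1 : ℝ); linarith
  nlinarith

end

section

open Filter Topology

lemma tsum_hasDeriv (F F' : ℤ × ℤ → ℂ → ℂ) (z : ℂ) (r : ℝ) (hr : 0 < r) (C : ℝ)
    (hF : ∀ p, ∀ w ∈ Metric.ball z r, HasDerivAt (F p) (F' p w) w)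
    (hb : ∀ p, ∀ w ∈ Metric.ball z r, ‖F p w‖ ≤ C * ((hNrm p) ^ 3)⁻¹) :
    HasDerivAt (fun w => ∑' p, F p w) (∑' p, F' p z) z := by
  have hs : Summable (fun p => C * ((hNrm p) ^ 3)⁻¹) := summable_hNrm.mul_left C
  have hd : ∀ p, DifferentiableOn ℂ (F p) (Metric.ball z r) := fun p w hw =>
    (hF p w hw).differentiableAt.differentiableWithinAt
  have hz : z ∈ Metric.ball z r := Metric.mem_ball_self hr
  have h1 := Complex.hasSum_deriv_of_summable_norm hs hd Metric.isOpen_ball hb hz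
  have h2 := Complex.differentiableOn_tsum_of_summable_norm hs hd Metric.isOpen_ball hb
  have h3 := (h2.differentiableAt (Metric.isOpen_ball.mem_nhds hz)).hasDerivAt
  rw [← h1.tsum_eq] at h3
  have e : ∀ p, F' p z = deriv (F p) z := fun p => (hF p z hz).deriv.symm
  rw [tsum_congr e]
  exact h3

/-- summand of zeta -/
def fT (t : ℂ) (p : ℤ × ℤ) (z : ℂ) : ℂ :=
  1 / (z - latPt t p) + 1 / latPt t p + z / (latPt t p) ^ 2

/-- summand of the derivative of zeta -/
def gT (t : ℂ) (p : ℤ × ℤ) (z : ℂ) : ℂ :=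
  -(1 / (z - latPt t p) ^ 2) + 1 / (latPt t p) ^ 2

/-- sum of inverse cubes -/
def P3 (t z : ℂ) : ℂ := ∑' p : ℤ × ℤ, 1 / (z - latPt t p) ^ 3

/-- sum of inverse fourth powers -/
def P4 (t z : ℂ) : ℂ := ∑' p : ℤ × ℤ, 1 / (z - latPt t p) ^ 4

/-- weighted sum of inverse fourth powers -/
def DD (t z : ℂ) : ℂ := ∑' p : ℤ × ℤ, (p.2 : ℂ) / (z - latPt t p) ^ 4

lemma latPt_zero (t : ℂ) : latPt t 0 = 0 := by simp [latPt]

lemma latPt_ne_zero (t : ℂ) (ht : 0 < t.im) (p : ℤ × ℤ) (hp : p ≠ 0) : latPt t p ≠ 0 := by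
  obtain ⟨c, hc, h⟩ := latPt_lower t ht
  intro h0
  have h1 := h p
  rw [h0, norm_zero] at h1
  have h2 : |(p.1 : ℝ)| + |(p.2 : ℝ)| ≤ 0 := by
    by_contra hcon
    push Not at hcon
    have := mul_pos hc hcon
    linarith
  have a1 := abs_nonneg (p.1 : ℝ)
  have a2 := abs_nonneg (p.2 : ℝ)
  apply hp
  have e1 : |(p.1 : ℝ)| = 0 := by linarith
  have e2 : |(p.2 : ℝ)| = 0 := by linarith
  rw [abs_eq_zero] at e1 e2
  exact Prod.ext (by exact_mod_cast e1) (by exact_mod_cast e2)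

lemma sub_latPt_ne (t z : ℂ) (hz : ¬ lat t z) (p : ℤ × ℤ) : z - latPt t p ≠ 0 := by
  intro h
  exact hz ⟨p.1, p.2, by rw [sub_eq_zero] at h; exact h⟩

/-- simple bounds -/
lemma inv_bound {c h : ℝ} (hc : 0 < c) (hh : 0 < h) {w : ℂ} (hw : c * h ≤ ‖w‖) :
    ‖w⁻¹‖ ≤ c⁻¹ * h⁻¹ := by
  rw [norm_inv, ← mul_inv]
  exact inv_anti₀ (by positivity) hw

lemma pow_three_bound {c : ℝ} (hc : 0 < c) (p : ℤ × ℤ) {w : ℂ} (hw : c * hNrm p ≤ ‖w‖) :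
    ‖1 / w ^ 3‖ ≤ (c⁻¹) ^ 3 * ((hNrm p) ^ 3)⁻¹ := by
  have h := inv_bound hc (hNrm_pos p) hw
  rw [one_div, ← inv_pow, norm_pow]
  calc ‖w⁻¹‖ ^ 3 ≤ (c⁻¹ * (hNrm p)⁻¹) ^ 3 := by gcongr
    _ = _ := by rw [mul_pow, inv_pow (hNrm p)]

lemma pow_four_bound {c : ℝ} (hc : 0 < c) (p : ℤ × ℤ) {w : ℂ} (hw : c * hNrm p ≤ ‖w‖) :
    ‖(p.2 : ℂ) / w ^ 4‖ ≤ (c⁻¹) ^ 4 * ((hNrm p) ^ 3)⁻¹ := by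
  have h := inv_bound hc (hNrm_pos p) hw
  have hn : |(p.2 : ℝ)| ≤ hNrm p := by
    unfold hNrm; have := abs_nonneg (p.1 : ℝ); linarith
  have hp := hNrm_pos p
  rw [div_eq_mul_inv, ← inv_pow, norm_mul, norm_pow, Complex.norm_intCast]
  calc |(p.2 : ℝ)| * ‖w⁻¹‖ ^ 4 ≤ hNrm p * (c⁻¹ * (hNrm p)⁻¹) ^ 4 := by gcongr
    _ = _ := by field_simp

lemma pow_four_bound' {c : ℝ} (hc : 0 < c) (p : ℤ × ℤ) {w : ℂ} (hw : c * hNrm p ≤ ‖w‖) :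
    ‖1 / w ^ 4‖ ≤ (c⁻¹) ^ 4 * ((hNrm p) ^ 3)⁻¹ := by
  have h := inv_bound hc (hNrm_pos p) hw
  have hp := hNrm_pos p
  have hp1 := hNrm_one_le p
  rw [one_div, ← inv_pow, norm_pow]
  calc ‖w⁻¹‖ ^ 4 ≤ (c⁻¹ * (hNrm p)⁻¹) ^ 4 := by gcongr
    _ = (c⁻¹) ^ 4 * ((hNrm p) ^ 4)⁻¹ := by rw [mul_pow, inv_pow (hNrm p)]
    _ ≤ _ := by
      gcongr
      norm_num

lemma uv_lemma (w o : ℂ) (ho : o ≠ 0) (hw : w - o ≠ 0) :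
    (w - o)⁻¹ + o⁻¹ = w * (w - o)⁻¹ * o⁻¹ := by
  field_simp
  ring

lemma f_bound {c R : ℝ} (hc : 0 < c) (p : ℤ × ℤ) {w o : ℂ} (hR : ‖w‖ ≤ R)
    (hw : c * hNrm p ≤ ‖w - o‖) (ho : c * hNrm p ≤ ‖o‖) :
    ‖1 / (w - o) + 1 / o + w / o ^ 2‖ ≤ R ^ 2 * (c⁻¹) ^ 3 * ((hNrm p) ^ 3)⁻¹ := by
  have hp := hNrm_pos p
  have h1 := inv_bound hc hp hw
  have h2 := inv_bound hc hp ho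
  have ho0 : o ≠ 0 := norm_pos_iff.mp (lt_of_lt_of_le (by positivity) ho)
  have hw0 : w - o ≠ 0 := norm_pos_iff.mp (lt_of_lt_of_le (by positivity) hw)
  have hR0 : 0 ≤ R := (norm_nonneg w).trans hR
  have e : 1 / (w - o) + 1 / o + w / o ^ 2 = w ^ 2 * (w - o)⁻¹ * o⁻¹ ^ 2 := by
    have := uv_lemma w o ho0 hw0
    field_simp
    ring
  rw [e, norm_mul, norm_mul, norm_pow, norm_pow]
  calc ‖w‖ ^ 2 * ‖(w - o)⁻¹‖ * ‖o⁻¹‖ ^ 2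
      ≤ R ^ 2 * (c⁻¹ * (hNrm p)⁻¹) * (c⁻¹ * (hNrm p)⁻¹) ^ 2 := by gcongr
    _ = _ := by field_simp

lemma g_bound {c R : ℝ} (hc : 0 < c) (p : ℤ × ℤ) {w o : ℂ} (hR : ‖w‖ ≤ R)
    (hw : c * hNrm p ≤ ‖w - o‖) (ho : c * hNrm p ≤ ‖o‖) :
    ‖-(1 / (w - o) ^ 2) + 1 / o ^ 2‖ ≤ 2 * R * (c⁻¹) ^ 3 * ((hNrm p) ^ 3)⁻¹ := by
  have hp := hNrm_pos p
  have h1 := inv_bound hc hp hw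
  have h2 := inv_bound hc hp ho
  have ho0 : o ≠ 0 := norm_pos_iff.mp (lt_of_lt_of_le (by positivity) ho)
  have hw0 : w - o ≠ 0 := norm_pos_iff.mp (lt_of_lt_of_le (by positivity) hw)
  have hR0 : 0 ≤ R := (norm_nonneg w).trans hR
  have e : -(1 / (w - o) ^ 2) + 1 / o ^ 2 = (o⁻¹ - (w - o)⁻¹) * (w * (w - o)⁻¹ * o⁻¹) := by
    rw [← uv_lemma w o ho0 hw0]
    field_simp
    ring
  rw [e, norm_mul, norm_mul, norm_mul]
  have h3 : ‖o⁻¹ - (w - o)⁻¹‖ ≤ c⁻¹ * (hNrm p)⁻¹ + c⁻¹ * (hNrm p)⁻¹ :=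
    (norm_sub_le _ _).trans (add_le_add h2 h1)
  calc ‖o⁻¹ - (w - o)⁻¹‖ * (‖w‖ * ‖(w - o)⁻¹‖ * ‖o⁻¹‖)
      ≤ (c⁻¹ * (hNrm p)⁻¹ + c⁻¹ * (hNrm p)⁻¹) * (R * (c⁻¹ * (hNrm p)⁻¹) * (c⁻¹ * (hNrm p)⁻¹)) := by
        gcongr
    _ = _ := by field_simp; ring

/-- All bounds near a non lattice point. -/
lemma bounds_fg (t : ℂ) (ht : 0 < t.im) (z : ℂ) (hz : ¬ lat t z) : ∃ r > 0, ∃ C : ℝ,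
    ∀ p, ∀ w ∈ Metric.ball z r, w - latPt t p ≠ 0 ∧ ‖fT t p w‖ ≤ C * ((hNrm p) ^ 3)⁻¹ ∧
      ‖gT t p w‖ ≤ C * ((hNrm p) ^ 3)⁻¹ := by
  obtain ⟨c1, hc1, h1⟩ := key_lower t ht z Set.univ (fun p _ => sub_latPt_ne t z hz p)
  obtain ⟨c2, hc2, h2⟩ := key_lower t ht 0 {p | p ≠ 0}
    (fun p hp => by simpa using latPt_ne_zero t ht p hp)
  set c := min c1 c2 with hc
  have hcpos : 0 < c := lt_min hc1 hc2
  set R := ‖z‖ + c with hR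
  have hRpos : 0 < R := by positivity
  refine ⟨c, hcpos, R ^ 2 * (c⁻¹) ^ 3 + 2 * R * (c⁻¹) ^ 3 + c⁻¹ + (c⁻¹) ^ 2, fun p w hw => ?_⟩
  have hp := hNrm_pos p
  have hw' : ‖w - z‖ < c := by rwa [← dist_eq_norm]
  have k1 : c * hNrm p ≤ ‖w - latPt t p‖ := by
    have := h1 w t (lt_of_lt_of_le hw' (min_le_left _ _)) (by simpa using hc1) p trivial
    refine le_trans ?_ this
    gcongr
    exact min_le_left _ _
  have kR : ‖w‖ ≤ R := by
    have := norm_add_le (w - z) z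
    rw [sub_add_cancel] at this
    linarith
  refine ⟨norm_pos_iff.mp (lt_of_lt_of_le (by positivity) k1), ?_⟩
  by_cases hp0 : p = 0
  · subst hp0
    have hh : hNrm 0 = 1 := by simp [hNrm]
    rw [latPt_zero, sub_zero, hh, mul_one] at k1
    have k2 : ‖w⁻¹‖ ≤ c⁻¹ := by rw [norm_inv]; exact inv_anti₀ hcpos k1
    have k3 : ‖w⁻¹‖ ^ 2 ≤ c⁻¹ ^ 2 := by gcongr
    have q1 : 0 ≤ R ^ 2 * (c⁻¹) ^ 3 := by positivity
    have q2 : 0 ≤ 2 * R * (c⁻¹) ^ 3 := by positivity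
    have q3 : 0 ≤ c⁻¹ := by positivity
    have q4 : 0 ≤ (c⁻¹) ^ 2 := by positivity
    constructor
    · simp only [fT, latPt_zero, hh]
      simp only [sub_zero, div_zero, one_div, add_zero, ne_eq, OfNat.ofNat_ne_zero,
        not_false_eq_true, zero_pow, one_pow, inv_one, mul_one]
      linarith
    · simp only [gT, latPt_zero, hh]
      simp only [sub_zero, div_zero, one_div, add_zero, ne_eq, OfNat.ofNat_ne_zero,
        not_false_eq_true, zero_pow, one_pow, inv_one, mul_one, norm_neg]
      rw [← inv_pow, norm_pow]
      linarith
  · have k2 : c * hNrm p ≤ ‖latPt t p‖ := by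
      have := h2 0 t (by simpa using hc2) (by simpa using hc2) p hp0
      rw [zero_sub, norm_neg] at this
      refine le_trans ?_ this
      gcongr
      exact min_le_right _ _
    have q : 0 ≤ ((hNrm p) ^ 3)⁻¹ := by positivity
    constructor
    · refine (f_bound hcpos p kR k1 k2).trans ?_
      refine mul_le_mul_of_nonneg_right ?_ q
      have : 0 ≤ 2 * R * c⁻¹ ^ 3 + c⁻¹ + c⁻¹ ^ 2 := by positivity
      linarith
    · refine (g_bound hcpos p kR k1 k2).trans ?_
      refine mul_le_mul_of_nonneg_right ?_ q
      have : 0 ≤ R ^ 2 * c⁻¹ ^ 3 + c⁻¹ + c⁻¹ ^ 2 := by positivity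
      linarith

lemma summable_of_bound (F : ℤ × ℤ → ℂ) (C : ℝ) (h : ∀ p, ‖F p‖ ≤ C * ((hNrm p) ^ 3)⁻¹) :
    Summable F :=
  Summable.of_norm_bounded (summable_hNrm.mul_left C) h

lemma summable_fT (t : ℂ) (ht : 0 < t.im) (z : ℂ) (hz : ¬ lat t z) :
    Summable (fun p => fT t p z) := by
  obtain ⟨r, hr, C, h⟩ := bounds_fg t ht z hz
  exact summable_of_bound _ C (fun p => (h p z (Metric.mem_ball_self hr)).2.1)

lemma wzeta_eq (t : ℂ) (ht : 0 < t.im) (z : ℂ) (hz : ¬ lat t z) :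
    wzeta t z = ∑' p, fT t p z := by
  have hs := summable_fT t ht z hz
  rw [← hs.tsum_subtype_add_tsum_subtype_compl {p | p ≠ 0}]
  have e : ({p : ℤ × ℤ | p ≠ 0}ᶜ) = {0} := by ext; simp
  rw [e, tsum_singleton 0 (fun p => fT t p z), add_comm]
  unfold wzeta
  congr 1
  simp [fT, latPt_zero]

lemma eventually_not_lat (t : ℂ) (ht : 0 < t.im) (z : ℂ) (hz : ¬ lat t z) :
    ∀ᶠ w in 𝓝 z, ¬ lat t w := by
  obtain ⟨r, hr, C, h⟩ := bounds_fg t ht z hz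
  filter_upwards [Metric.ball_mem_nhds z hr] with w hw
  rintro ⟨m, n, e⟩
  have := (h (m, n) w hw).1
  apply this
  rw [e]; simp [latPt]

lemma hasDerivAt_wzeta0 (t : ℂ) (ht : 0 < t.im) (z : ℂ) (hz : ¬ lat t z) :
    HasDerivAt (wzeta t) (∑' p, gT t p z) z := by
  obtain ⟨r, hr, C, h⟩ := bounds_fg t ht z hz
  have h1 := tsum_hasDeriv (fT t) (gT t) z r hr C (fun p w hw => ?_) (fun p w hw => (h p w hw).2.1)
  · refine h1.congr_of_eventuallyEq ?_
    filter_upwards [eventually_not_lat t ht z hz] with w hw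
    exact wzeta_eq t ht w hw
  · have hne := (h p w hw).1
    have d1 := (((hasDerivAt_id w).sub_const (latPt t p)).inv hne).add_const (1 / latPt t p)
    have d2 := d1.add ((hasDerivAt_id w).div_const ((latPt t p) ^ 2))
    unfold gT
    convert! d2 using 1
    · ext x
      simp [fT]
    · simp; field_simp

lemma wp_eq (t : ℂ) (ht : 0 < t.im) (z : ℂ) (hz : ¬ lat t z) :
    wp t z = - ∑' p, gT t p z := by
  unfold wp
  rw [(hasDerivAt_wzeta0 t ht z hz).deriv]

lemma hasDerivAt_wzeta (t : ℂ) (ht : 0 < t.im) (z : ℂ) (hz : ¬ lat t z) :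
    HasDerivAt (wzeta t) (-(wp t z)) z := by
  rw [wp_eq t ht z hz, neg_neg]
  exact hasDerivAt_wzeta0 t ht z hz

lemma hasDerivAt_inv_pow (o w : ℂ) (k : ℕ) (h : w - o ≠ 0) :
    HasDerivAt (fun x : ℂ => 1 / (x - o) ^ k) (-(k : ℂ) * (1 / (w - o) ^ (k + 1))) w := by
  have d := (((hasDerivAt_id w).sub_const o).pow k).inv (pow_ne_zero k h)
  convert! d using 1
  · ext x; simp
  · rcases k with _ | k
    · simp
    · simp
      field_simp
      ring

lemma hasDerivAt_wp (t : ℂ) (ht : 0 < t.im) (z : ℂ) (hz : ¬ lat t z) :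
    HasDerivAt (wp t) (-2 * P3 t z) z := by
  obtain ⟨r, hr, C, h⟩ := bounds_fg t ht z hz
  have h1 := tsum_hasDeriv (gT t) (fun p w => 2 * (1 / (w - latPt t p) ^ 3)) z r hr C
    (fun p w hw => ?_) (fun p w hw => (h p w hw).2.2)
  · rw [tsum_mul_left] at h1
    have h2 := h1.neg
    have e : -2 * P3 t z = -(2 * ∑' p, 1 / (z - latPt t p) ^ 3) := by unfold P3; ring
    rw [e]
    refine h2.congr_of_eventuallyEq ?_
    filter_upwards [eventually_not_lat t ht z hz] with w hw
    exact wp_eq t ht w hw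
  · have hne := (h p w hw).1
    have d := (hasDerivAt_inv_pow (latPt t p) w 2 hne).neg.add_const (1 / (latPt t p) ^ 2)
    convert! d using 1
    simp

/-- generic lower bound near a non lattice point, with only `z` varying -/
lemma lower_z (t : ℂ) (ht : 0 < t.im) (z : ℂ) (hz : ¬ lat t z) : ∃ c > 0,
    ∀ p, ∀ w ∈ Metric.ball z c, c * hNrm p ≤ ‖w - latPt t p‖ := by
  obtain ⟨c1, hc1, h1⟩ := key_lower t ht z Set.univ (fun p _ => sub_latPt_ne t z hz p)
  refine ⟨c1, hc1, fun p w hw => h1 w t (by rwa [← dist_eq_norm]) (by simpa using hc1) p trivial⟩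

lemma ne_of_lower {c : ℝ} (hc : 0 < c) {p : ℤ × ℤ} {w : ℂ} (h : c * hNrm p ≤ ‖w‖) : w ≠ 0 := by
  have := hNrm_pos p
  exact norm_pos_iff.mp (lt_of_lt_of_le (by positivity) h)

lemma hasDerivAt_P3 (t : ℂ) (ht : 0 < t.im) (z : ℂ) (hz : ¬ lat t z) :
    HasDerivAt (P3 t) (-3 * P4 t z) z := by
  obtain ⟨c, hc, h⟩ := lower_z t ht z hz
  have h1 := tsum_hasDeriv (fun p w => 1 / (w - latPt t p) ^ 3)
    (fun p w => -3 * (1 / (w - latPt t p) ^ 4)) z c hc _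
    (fun p w hw => ?_) (fun p w hw => pow_three_bound hc p (h p w hw))
  · rw [tsum_mul_left] at h1
    exact h1
  · have d := hasDerivAt_inv_pow (latPt t p) w 3 (ne_of_lower hc (h p w hw))
    convert! d using 1

lemma differentiableAt_P4 (t : ℂ) (ht : 0 < t.im) (z : ℂ) (hz : ¬ lat t z) :
    DifferentiableAt ℂ (P4 t) z := by
  obtain ⟨c, hc, h⟩ := lower_z t ht z hz
  have h1 := tsum_hasDeriv (fun p w => 1 / (w - latPt t p) ^ 4)
    (fun p w => -((4 : ℕ) : ℂ) * (1 / (w - latPt t p) ^ 5)) z c hc _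
    (fun p w hw => ?_) (fun p w hw => pow_four_bound' hc p (h p w hw))
  · exact h1.differentiableAt
  · exact hasDerivAt_inv_pow (latPt t p) w 4 (ne_of_lower hc (h p w hw))

lemma differentiableAt_DD (t : ℂ) (ht : 0 < t.im) (z : ℂ) (hz : ¬ lat t z) :
    DifferentiableAt ℂ (DD t) z := by
  obtain ⟨c, hc, h⟩ := lower_z t ht z hz
  have h1 := tsum_hasDeriv (fun p w => (p.2 : ℂ) / (w - latPt t p) ^ 4)
    (fun p w => (p.2 : ℂ) * (-((4 : ℕ) : ℂ) * (1 / (w - latPt t p) ^ 5))) z c hc _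
    (fun p w hw => ?_) (fun p w hw => pow_four_bound hc p (h p w hw))
  · exact h1.differentiableAt
  · have d := (hasDerivAt_inv_pow (latPt t p) w 4 (ne_of_lower hc (h p w hw))).const_mul (p.2 : ℂ)
    convert! d using 1
    ext x; ring

/-- DD is differentiable at the origin -/
lemma differentiableAt_DD_zero (t : ℂ) (ht : 0 < t.im) : DifferentiableAt ℂ (DD t) 0 := by
  obtain ⟨c, hc, h⟩ := key_lower t ht 0 {p | p ≠ 0}
    (fun p hp => by simpa using latPt_ne_zero t ht p hp)
  have h' : ∀ p, p ≠ 0 → ∀ w ∈ Metric.ball (0 : ℂ) c, c * hNrm p ≤ ‖w - latPt t p‖ :=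
    fun p hp w hw => h w t (by rwa [← dist_eq_norm]) (by simpa using hc) p hp
  have h1 := tsum_hasDeriv (fun p w => (p.2 : ℂ) / (w - latPt t p) ^ 4)
    (fun p w => (p.2 : ℂ) * (-((4 : ℕ) : ℂ) * (1 / (w - latPt t p) ^ 5))) 0 c hc (c⁻¹ ^ 4)
    (fun p w hw => ?_) (fun p w hw => ?_)
  · exact h1.differentiableAt
  · by_cases hp : p = 0
    · subst hp
      simpa using hasDerivAt_const w (0 : ℂ)
    have d := (hasDerivAt_inv_pow (latPt t p) w 4 (ne_of_lower hc (h' p hp w hw))).const_mul (p.2 : ℂ)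
    convert! d using 1
    ext x; ring
  · by_cases hp : p = 0
    · subst hp
      have := hNrm_pos 0
      simp
      positivity
    exact pow_four_bound hc p (h' p hp w hw)

/-- derivative in the modulus -/
lemma hasDerivAt_P3_tau (τ : ℂ) (hτ : 0 < τ.im) (z : ℂ) (hz : ¬ lat τ z) :
    HasDerivAt (fun t => P3 t z) (3 * DD τ z) τ := by
  obtain ⟨c, hc, h⟩ := key_lower τ hτ z Set.univ (fun p _ => sub_latPt_ne τ z hz p)
  have h' : ∀ p, ∀ t ∈ Metric.ball τ c, c * hNrm p ≤ ‖z - latPt t p‖ :=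
    fun p t htt => h z t (by simpa using hc) (by rwa [← dist_eq_norm]) p trivial
  have h1 := tsum_hasDeriv (fun p t => 1 / (z - latPt t p) ^ 3)
    (fun p t => 3 * ((p.2 : ℂ) / (z - latPt t p) ^ 4)) τ c hc _
    (fun p t htt => ?_) (fun p t htt => pow_three_bound hc p (h' p t htt))
  · rw [tsum_mul_left] at h1
    exact h1
  · have hne := ne_of_lower hc (h' p t htt)
    have d1 : HasDerivAt (fun x => z - latPt x p) (-(p.2 : ℂ)) t := by
      have := (((hasDerivAt_id t).const_mul (p.2 : ℂ)).const_add (p.1 : ℂ)).const_sub z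
      simpa [latPt] using this
    have d := (d1.pow 3).inv (pow_ne_zero 3 hne)
    convert! d using 1
    · ext x; simp
    · simp
      field_simp

lemma eventually_not_lat_tau (τ : ℂ) (hτ : 0 < τ.im) (z : ℂ) (hz : ¬ lat τ z) :
    ∀ᶠ t in 𝓝 τ, 0 < t.im ∧ ¬ lat t z := by
  obtain ⟨c, hc, h⟩ := key_lower τ hτ z Set.univ (fun p _ => sub_latPt_ne τ z hz p)
  have h0 : ∀ᶠ t in 𝓝 τ, 0 < t.im := Complex.continuous_im.continuousAt.eventually (lt_mem_nhds hτ)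
  filter_upwards [Metric.ball_mem_nhds τ hc, h0] with t htt h0
  refine ⟨h0, ?_⟩
  rintro ⟨m, n, e⟩
  have h1 := h z t (by simpa using hc) (by rwa [← dist_eq_norm]) (m, n) trivial
  refine ne_of_lower hc h1 ?_
  rw [e]; simp [latPt]

/-- tau-derivative in the form of the theorem -/
lemma deriv_tau (τ : ℂ) (hτ : 0 < τ.im) (z : ℂ) (hz : ¬ lat τ z) :
    deriv (fun t => deriv (wp t) z) τ = -6 * DD τ z := by
  have h : (fun t => deriv (wp t) z) =ᶠ[𝓝 τ] fun t => -2 * P3 t z := by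
    filter_upwards [eventually_not_lat_tau τ hτ z hz] with t ht
    exact (hasDerivAt_wp t ht.1 z ht.2).deriv
  rw [h.deriv_eq, ((hasDerivAt_P3_tau τ hτ z hz).const_mul (-2)).deriv]
  ring

lemma deriv_wp (τ : ℂ) (hτ : 0 < τ.im) (z : ℂ) (hz : ¬ lat τ z) :
    deriv (wp τ) z = -2 * P3 τ z := (hasDerivAt_wp τ hτ z hz).deriv

lemma deriv_deriv_wp (τ : ℂ) (hτ : 0 < τ.im) (z : ℂ) (hz : ¬ lat τ z) :
    deriv (deriv (wp τ)) z = 6 * P4 τ z := by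
  have h : deriv (wp τ) =ᶠ[𝓝 z] fun w => -2 * P3 τ w := by
    filter_upwards [eventually_not_lat τ hτ z hz] with w hw
    exact deriv_wp τ hτ w hw
  rw [h.deriv_eq, ((hasDerivAt_P3 τ hτ z hz).const_mul (-2)).deriv]
  ring

end

section

open Filter Topology

/-- the function `π cot (π u)`. -/
def pc (u : ℂ) : ℂ := (Real.pi : ℂ) * Complex.cot ((Real.pi : ℂ) * u)

lemma pc_eq (u : ℂ) : pc u = (Real.pi : ℂ) * ((Complex.exp (i2pi * u) + 1) /
    (Complex.I * (1 - Complex.exp (i2pi * u)))) := by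
  unfold pc
  rw [Complex.cot_pi_eq_exp_ratio]
  rfl

lemma pc_neg (u : ℂ) : pc (-u) = - pc u := by
  unfold pc
  rw [mul_neg, Complex.cot, Complex.cot, Complex.sin_neg, Complex.cos_neg, div_neg, mul_neg]

lemma pc_add_int (u : ℂ) (m : ℤ) : pc (u + m) = pc u := by
  rw [pc_eq, pc_eq, mul_add, Complex.exp_add]
  have : Complex.exp (i2pi * m) = 1 := by
    rw [mul_comm]
    exact Complex.exp_int_mul_two_pi_mul_I m
  rw [this, mul_one]

lemma cot_hasSum (u : ℂ) (hu : u ∈ Complex.integerComplement) :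
    HasSum (fun m : ℤ => 1 / (u - m) + 1 / (m : ℂ)) (pc u) := by
  have hne : ∀ m : ℤ, u - m ≠ 0 := fun m h => hu ⟨m, (sub_eq_zero.mp h).symm⟩
  have hs : Summable (fun m : ℤ => 1 / (u - m) + 1 / (m : ℂ)) := by
    have h := (EisensteinSeries.summable_linear_sub_mul_linear_add u 1 0).mul_left u
    rw [← Finset.summable_compl_iff {(0 : ℤ)}] at h ⊢
    refine h.congr fun m => ?_
    have hm : ((m : ℤ) : ℂ) ≠ 0 := by
      have := m.2
      simp at this
      exact_mod_cast this
    have := hne m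
    simp only [Int.cast_one, one_mul, Int.cast_zero, zero_mul, zero_add]
    field_simp
    ring
  have hv := tsum_int_eq_zero_add_tsum_pnat hs
  have e : ∑' m : ℤ, (1 / (u - m) + 1 / (m : ℂ)) = pc u := by
    rw [hv]
    have h1 : Summable (fun n : ℕ+ => 1 / (u - ((n : ℤ) : ℂ)) + 1 / ((n : ℤ) : ℂ)) :=
      hs.comp_injective (i := fun n : ℕ+ => (n : ℤ)) (fun a b h => by
        simp at h; exact h)
    have h2 : Summable (fun n : ℕ+ => 1 / (u - ((-(n : ℤ) : ℤ) : ℂ)) + 1 / ((-(n : ℤ) : ℤ) : ℂ)) :=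
      hs.comp_injective (i := fun n : ℕ+ => -(n : ℤ)) (fun a b h => by
        simp at h; exact h)
    have h3 := h1.tsum_add h2
    unfold pc
    rw [cot_series_rep hu, add_assoc]
    congr 1
    · simp
    · refine h3.symm.trans ?_
      refine tsum_congr fun n => ?_
      push_cast
      have : ((n : ℕ) : ℂ) ≠ 0 := by exact_mod_cast n.ne_zero
      rw [sub_neg_eq_add]
      field_simp
      ring
  rw [← e]
  exact hs.hasSum

lemma mul_tau_mem (τ : ℂ) (hτ : 0 < τ.im) (n : ℤ) (hn : n ≠ 0) :
    -((n : ℂ) * τ) ∈ Complex.integerComplement := by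
  rintro ⟨m, hm⟩
  have := congrArg Complex.im hm
  simp at this
  rcases this with h | h
  · exact hn h
  · exact hτ.ne' h

lemma cot_hasSum' (τ : ℂ) (hτ : 0 < τ.im) (n : ℤ) :
    HasSum (fun m : ℤ => 1 / ((m : ℂ) + n * τ) - 1 / (m : ℂ)) (pc (n * τ)) := by
  by_cases hn : n = 0
  · subst hn
    simp [pc, Complex.cot]
  · have h := (cot_hasSum _ (mul_tau_mem τ hτ n hn)).neg
    rw [pc_neg, neg_neg] at h
    refine h.congr_fun ?_ |> fun h => h
    intro m
    have : -((n : ℂ) * τ) - m = -((m : ℂ) + n * τ) := by ring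
    rw [this, one_div_neg_eq_neg_one_div]
    ring

lemma e2_hasSum (τ : ℂ) (hτ : 0 < τ.im) (n : ℤ) :
    HasSum (fun m : ℤ => 1 / ((m : ℂ) + n * τ) ^ 2) (EisensteinSeries.e2Summand n ⟨τ, hτ⟩) := by
  have h := (EisensteinSeries.e2Summand_summable n ⟨τ, hτ⟩).hasSum
  unfold EisensteinSeries.e2Summand
  convert! h using 1
  ext m
  simp [EisensteinSeries.eisSummand]
  rw [add_comm]
lemma fib_hasSum (τ : ℂ) (hτ : 0 < τ.im) (z : ℂ) (hz : ¬ lat τ z) (n : ℤ) :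
    HasSum (fun m : ℤ => fT τ (m, n) z)
      (pc (z - n * τ) + pc (n * τ) + z * EisensteinSeries.e2Summand n ⟨τ, hτ⟩) := by
  have hu : z - n * τ ∈ Complex.integerComplement := by
    rintro ⟨m, hm⟩
    exact hz ⟨m, n, by linear_combination -hm⟩
  have h := ((cot_hasSum _ hu).add (cot_hasSum' τ hτ n)).add ((e2_hasSum τ hτ n).mul_left z)
  convert! h using 1
  ext m
  simp only [fT, latPt]
  rw [show z - ((m : ℂ) + n * τ) = z - n * τ - m by ring]
  ring

/-- the constant in the cotangent expansion -/
def GG (τ : ℂ) (hτ : 0 < τ.im) : ℂ := EisensteinSeries.G2 ⟨τ, hτ⟩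

lemma cot_tendsto (τ : ℂ) (hτ : 0 < τ.im) (z : ℂ) (hz : ¬ lat τ z) :
    Tendsto (fun N : ℕ => ∑ n ∈ Finset.Icc (-(N : ℤ)) N, pc (z - n * τ)) atTop
      (𝓝 (wzeta τ z - GG τ hτ * z)) := by
  have h1 := (summable_fT τ hτ z hz).hasSum
  rw [← wzeta_eq τ hτ z hz] at h1
  have h2 := ((Equiv.prodComm ℤ ℤ).hasSum_iff).mpr h1
  have h3 := h2.prod_fiberwise (fun n => fib_hasSum τ hτ z hz n)
  have h4 := h3.mono_left (SummationFilter.symmetricIcc ℤ).le_atTop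
  have h5 := EisensteinSeries.hasSum_e2Summand_symmetricIcc ⟨τ, hτ⟩
  rw [← EisensteinSeries.G2_eq_tsum_cexp] at h5
  simp only [HasSum, SummationFilter.symmetricIcc_eq_map_Icc_nat, tendsto_map'_iff] at h4 h5
  have h6 := h4.sub (h5.const_mul z)
  unfold GG
  rw [mul_comm _ z]
  refine h6.congr fun N => ?_
  simp only [Function.comp]
  rw [Finset.mul_sum, ← Finset.sum_sub_distrib]
  have odd : ∑ n ∈ Finset.Icc (-(N : ℤ)) N, pc (n * τ) = 0 := by
    have e : ∑ n ∈ Finset.Icc (-(N : ℤ)) N, pc (n * τ)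
        = ∑ n ∈ Finset.Icc (-(N : ℤ)) N, - pc (n * τ) := by
      refine Finset.sum_nbij' (fun n => -n) (fun n => -n) ?_ ?_ ?_ ?_ ?_
      · intro a ha; simp at ha ⊢; omega
      · intro a ha; simp at ha ⊢; omega
      · intro a _; simp
      · intro a _; simp
      · intro a _
        rw [← pc_neg]
        congr 1
        push_cast
        ring
    rw [Finset.sum_neg_distrib] at e
    linear_combination e / 2
  simp only [add_sub_cancel_right, Finset.sum_add_distrib, odd, add_zero]

end

section

open Filter Topology

lemma lat_add_one (τ z : ℂ) (hz : ¬ lat τ z) : ¬ lat τ (z + 1) := by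
  rintro ⟨m, n, h⟩
  exact hz ⟨m - 1, n, by push_cast; linear_combination h⟩

lemma lat_add_tau (τ z : ℂ) (hz : ¬ lat τ z) : ¬ lat τ (z + τ) := by
  rintro ⟨m, n, h⟩
  exact hz ⟨m, n - 1, by push_cast; linear_combination h⟩

lemma lat_neg (τ z : ℂ) (hz : ¬ lat τ z) : ¬ lat τ (-z) := by
  rintro ⟨m, n, h⟩
  exact hz ⟨-m, -n, by push_cast; linear_combination -h⟩

lemma i2pi_ne : i2pi ≠ 0 := Complex.two_pi_I_ne_zero

lemma zhat_add_one (τ : ℂ) (hτ : 0 < τ.im) (z : ℂ) (hz : ¬ lat τ z) :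
    wzeta τ (z + 1) - GG τ hτ * (z + 1) = wzeta τ z - GG τ hτ * z := by
  refine tendsto_nhds_unique (cot_tendsto τ hτ (z + 1) (lat_add_one τ z hz)) ?_
  refine (cot_tendsto τ hτ z hz).congr fun N => Finset.sum_congr rfl fun n _ => ?_
  have := pc_add_int (z - n * τ) 1
  rw [← this]
  congr 1
  push_cast
  ring

lemma pc_tendsto (τ : ℂ) (hτ : 0 < τ.im) (w : ℂ) :
    Tendsto (fun N : ℕ => pc (w + N * τ)) atTop (𝓝 (-(Real.pi * Complex.I))) := by
  have hq : ‖Complex.exp (i2pi * τ)‖ < 1 := UpperHalfPlane.norm_exp_two_pi_I_lt_one ⟨τ, hτ⟩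
  have h1 : Tendsto (fun N : ℕ => Complex.exp (i2pi * (w + N * τ))) atTop (𝓝 0) := by
    have := (tendsto_pow_atTop_nhds_zero_of_norm_lt_one hq).const_mul (Complex.exp (i2pi * w))
    rw [mul_zero] at this
    refine this.congr fun N => ?_
    rw [← Complex.exp_nat_mul, ← Complex.exp_add]
    congr 1
    ring
  simp only [pc_eq]
  have h2 : Tendsto (fun x : ℂ => (Real.pi : ℂ) * ((x + 1) / (Complex.I * (1 - x)))) (𝓝 0)
      (𝓝 ((Real.pi : ℂ) * ((0 + 1) / (Complex.I * (1 - 0))))) := by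
    apply ContinuousAt.tendsto
    have : Complex.I * (1 - 0) ≠ 0 := by simp
    fun_prop (disch := exact this)
  have e : (Real.pi : ℂ) * ((0 + 1) / (Complex.I * (1 - 0))) = -(Real.pi * Complex.I) := by
    simp
  rw [← e]
  exact h2.comp h1

lemma telescope (τ z : ℂ) (N : ℕ) :
    ∑ n ∈ Finset.Icc (-(N : ℤ)) N, pc (z + τ - n * τ)
      = (∑ n ∈ Finset.Icc (-(N : ℤ)) N, pc (z - n * τ)) + pc (z + τ + N * τ)
        + pc (-z + N * τ) := by
  have key : ∀ N : ℕ, ∑ n ∈ Finset.Icc (-(N : ℤ)) N, (pc (z + τ - n * τ) - pc (z - n * τ))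
      = pc (z + τ + N * τ) - pc (z - N * τ) := by
    intro N
    induction N with
    | zero => simp
    | succ k ih =>
      have e : Finset.Icc (-((k + 1 : ℕ) : ℤ)) ((k + 1 : ℕ) : ℤ)
          = insert ((k : ℤ) + 1) (insert (-(k : ℤ) - 1) (Finset.Icc (-(k : ℤ)) k)) := by
        ext a; simp; omega
      rw [e, Finset.sum_insert (by simp; omega), Finset.sum_insert (by simp), ih]
      push_cast
      rw [show z + τ - ((k : ℂ) + 1) * τ = z - k * τ by ring,
        show z + τ - (-(k : ℂ) - 1) * τ = z + τ + (k + 1) * τ by ring,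
        show z - (-(k : ℂ) - 1) * τ = z + τ + k * τ by ring]
      ring
  have h := key N
  rw [Finset.sum_sub_distrib, show z - (N : ℂ) * τ = -(-z + N * τ) by ring, pc_neg] at h
  linear_combination h

lemma zhat_add_tau (τ : ℂ) (hτ : 0 < τ.im) (z : ℂ) (hz : ¬ lat τ z) :
    wzeta τ (z + τ) - GG τ hτ * (z + τ) = wzeta τ z - GG τ hτ * z - i2pi := by
  refine tendsto_nhds_unique (cot_tendsto τ hτ (z + τ) (lat_add_tau τ z hz)) ?_
  simp only [telescope]
  have h := ((cot_tendsto τ hτ z hz).add (pc_tendsto τ hτ (z + τ))).add (pc_tendsto τ hτ (-z))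
  convert! h using 2
  unfold i2pi
  ring

lemma half_not_lat (τ : ℂ) (hτ : 0 < τ.im) : ¬ lat τ (-(1 / 2)) := by
  rintro ⟨m, n, h⟩
  have h1 := congrArg Complex.im h
  have h2 := congrArg Complex.re h
  simp at h1 h2
  rcases h1 with h1 | h1
  · subst h1
    simp at h2
    have : (2 * m : ℝ) = -1 := by linarith
    have : (2 * m : ℤ) = -1 := by exact_mod_cast this
    omega
  · exact hτ.ne' h1

lemma eta1_eq (τ : ℂ) (hτ : 0 < τ.im) : eta1 τ = GG τ hτ := by
  have h := zhat_add_one τ hτ _ (half_not_lat τ hτ)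
  unfold eta1
  rw [show (-(1 / 2) : ℂ) + 1 = 1 / 2 by norm_num] at h
  linear_combination h

lemma eta1_E2 (τ : ℂ) (hτ : 0 < τ.im) :
    i2pi ^ 2 * E2 (Complex.exp (i2pi * τ)) / 12 = - eta1 τ := by
  have hq : ‖Complex.exp (i2pi * τ)‖ < 1 := UpperHalfPlane.norm_exp_two_pi_I_lt_one ⟨τ, hτ⟩
  have h := tsum_pow_div_one_sub_eq_tsum_sigma hq 1
  rw [eta1_eq τ hτ, GG, EisensteinSeries.G2_eq_tsum_cexp, riemannZeta_two]
  simp only [pow_one] at h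
  unfold E2
  rw [h]
  unfold i2pi
  simp only [mul_pow, Complex.I_sq]
  ring

lemma zeta1_add_one (τ : ℂ) (hτ : 0 < τ.im) (z : ℂ) (hz : ¬ lat τ z) :
    zeta1 τ (z + 1) = zeta1 τ z := by
  unfold zeta1
  rw [eta1_eq τ hτ, zhat_add_one τ hτ z hz]

lemma zeta1_add_tau (τ : ℂ) (hτ : 0 < τ.im) (z : ℂ) (hz : ¬ lat τ z) :
    zeta1 τ (z + τ) = zeta1 τ z + 1 := by
  unfold zeta1
  rw [eta1_eq τ hτ, zhat_add_tau τ hτ z hz]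
  have := i2pi_ne
  field_simp
  ring

end

section

open Filter Topology

lemma latPt_sub (t : ℂ) (p a : ℤ × ℤ) : latPt t (p - a) = latPt t p - latPt t a := by
  simp [latPt]; ring

lemma latPt_neg (t : ℂ) (p : ℤ × ℤ) : latPt t (-p) = - latPt t p := by
  simp [latPt]; ring

lemma P3_shift (t z : ℂ) (a : ℤ × ℤ) : P3 t (z + latPt t a) = P3 t z := by
  unfold P3
  rw [← (Equiv.subRight a).tsum_eq (fun p => 1 / (z - latPt t p) ^ 3)]
  refine tsum_congr fun p => ?_
  rw [Equiv.subRight_apply, latPt_sub]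
  ring_nf

lemma P4_shift (t z : ℂ) (a : ℤ × ℤ) : P4 t (z + latPt t a) = P4 t z := by
  unfold P4
  rw [← (Equiv.subRight a).tsum_eq (fun p => 1 / (z - latPt t p) ^ 4)]
  refine tsum_congr fun p => ?_
  rw [Equiv.subRight_apply, latPt_sub]
  ring_nf

lemma summable_P4 (t : ℂ) (ht : 0 < t.im) (z : ℂ) (hz : ¬ lat t z) :
    Summable (fun p => 1 / (z - latPt t p) ^ 4) := by
  obtain ⟨c, hc, h⟩ := lower_z t ht z hz
  exact summable_of_bound _ _ (fun p => pow_four_bound' hc p (h p z (Metric.mem_ball_self hc)))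

lemma summable_DD (t : ℂ) (ht : 0 < t.im) (z : ℂ) (hz : ¬ lat t z) :
    Summable (fun p : ℤ × ℤ => (p.2 : ℂ) / (z - latPt t p) ^ 4) := by
  obtain ⟨c, hc, h⟩ := lower_z t ht z hz
  exact summable_of_bound _ _ (fun p => pow_four_bound hc p (h p z (Metric.mem_ball_self hc)))

lemma DD_shift (t : ℂ) (ht : 0 < t.im) (z : ℂ) (hz : ¬ lat t z) (a : ℤ × ℤ) :
    DD t (z + latPt t a) = DD t z + a.2 * P4 t z := by
  unfold DD P4
  rw [← tsum_mul_left, ← (summable_DD t ht z hz).tsum_add ((summable_P4 t ht z hz).mul_left _)]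
  rw [← (Equiv.subRight a).tsum_eq
    (fun p : ℤ × ℤ => (p.2 : ℂ) / (z - latPt t p) ^ 4 + a.2 * (1 / (z - latPt t p) ^ 4))]
  refine tsum_congr fun p => ?_
  rw [Equiv.subRight_apply, latPt_sub]
  have : z + latPt t a - latPt t p = z - (latPt t p - latPt t a) := by ring
  rw [this]
  simp only [Prod.snd_sub]
  push_cast
  ring

lemma P3_neg (t z : ℂ) : P3 t (-z) = - P3 t z := by
  unfold P3
  rw [← (Equiv.neg (ℤ × ℤ)).tsum_eq (fun p => 1 / (z - latPt t p) ^ 3), ← tsum_neg]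
  refine tsum_congr fun p => ?_
  rw [Equiv.neg_apply, latPt_neg, show -z - latPt t p = -(z - -latPt t p) by ring,
    Odd.neg_pow (by decide), div_neg]

lemma P4_neg (t z : ℂ) : P4 t (-z) = P4 t z := by
  unfold P4
  rw [← (Equiv.neg (ℤ × ℤ)).tsum_eq (fun p => 1 / (z - latPt t p) ^ 4)]
  refine tsum_congr fun p => ?_
  rw [Equiv.neg_apply, latPt_neg, show -z - latPt t p = -(z - -latPt t p) by ring,
    Even.neg_pow (by decide)]

lemma DD_neg (t z : ℂ) : DD t (-z) = - DD t z := by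
  unfold DD
  rw [← (Equiv.neg (ℤ × ℤ)).tsum_eq (fun p : ℤ × ℤ => (p.2 : ℂ) / (z - latPt t p) ^ 4), ← tsum_neg]
  refine tsum_congr fun p => ?_
  rw [Equiv.neg_apply, latPt_neg, show -z - latPt t p = -(z - -latPt t p) by ring,
    Even.neg_pow (by decide)]
  simp only [Prod.snd_neg]
  push_cast
  ring

lemma wzeta_neg (t : ℂ) (ht : 0 < t.im) (z : ℂ) (hz : ¬ lat t z) :
    wzeta t (-z) = - wzeta t z := by
  rw [wzeta_eq t ht z hz, wzeta_eq t ht _ (lat_neg t z hz)]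
  rw [← (Equiv.neg (ℤ × ℤ)).tsum_eq (fun p : ℤ × ℤ => fT t p z), ← tsum_neg]
  refine tsum_congr fun p => ?_
  unfold fT
  rw [Equiv.neg_apply, latPt_neg, show -z - latPt t p = -(z - -latPt t p) by ring,
    Even.neg_pow (by decide), div_neg, div_neg]
  ring

lemma wp_neg (t : ℂ) (ht : 0 < t.im) (z : ℂ) (hz : ¬ lat t z) :
    wp t (-z) = wp t z := by
  rw [wp_eq t ht z hz, wp_eq t ht _ (lat_neg t z hz)]
  rw [← (Equiv.neg (ℤ × ℤ)).tsum_eq (fun p : ℤ × ℤ => gT t p z)]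
  congr 1
  refine tsum_congr fun p => ?_
  unfold gT
  rw [Equiv.neg_apply, latPt_neg, show -z - latPt t p = -(z - -latPt t p) by ring,
    Even.neg_pow (by decide), Even.neg_pow (by decide)]

lemma wp_shift_aux (t : ℂ) (ht : 0 < t.im) (z a C : ℂ) (hz : ¬ lat t z) (hza : ¬ lat t (z + a))
    (h : ∀ w, ¬ lat t w → wzeta t (w + a) = wzeta t w + C) : wp t (z + a) = wp t z := by
  have h1 := (hasDerivAt_wzeta t ht (z + a) hza).comp_add_const z a
  have h2 := (hasDerivAt_wzeta t ht z hz).add_const C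
  have h3 := h1.congr_of_eventuallyEq (f₁ := fun w => wzeta t w + C) (by
    filter_upwards [eventually_not_lat t ht z hz] with w hw
    exact (h w hw).symm)
  exact neg_injective (h3.unique h2)

lemma wp_add_one (t : ℂ) (ht : 0 < t.im) (z : ℂ) (hz : ¬ lat t z) :
    wp t (z + 1) = wp t z :=
  wp_shift_aux t ht z 1 (GG t ht) hz (lat_add_one t z hz) (fun w hw => by
    linear_combination zhat_add_one t ht w hw)

lemma wp_add_tau (t : ℂ) (ht : 0 < t.im) (z : ℂ) (hz : ¬ lat t z) :
    wp t (z + t) = wp t z :=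
  wp_shift_aux t ht z t (GG t ht * t - i2pi) hz (lat_add_tau t z hz) (fun w hw => by
    linear_combination zhat_add_tau t ht w hw)

/-- the defect in the identity -/
def FF (τ z : ℂ) : ℂ := -6 * DD τ z + zeta1 τ z * (6 * P4 τ z)
  - i2pi⁻¹ * 3 * (wp τ z - eta1 τ) * (-2 * P3 τ z)

lemma FF_add_one (τ : ℂ) (hτ : 0 < τ.im) (z : ℂ) (hz : ¬ lat τ z) :
    FF τ (z + 1) = FF τ z := by
  have e : latPt τ (1, 0) = 1 := by simp [latPt]
  have h1 := P3_shift τ z (1, 0)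
  have h2 := P4_shift τ z (1, 0)
  have h3 := DD_shift τ hτ z hz (1, 0)
  rw [e] at h1 h2 h3
  unfold FF
  rw [h1, h2, h3, wp_add_one τ hτ z hz, zeta1_add_one τ hτ z hz]
  simp

lemma FF_add_tau (τ : ℂ) (hτ : 0 < τ.im) (z : ℂ) (hz : ¬ lat τ z) :
    FF τ (z + τ) = FF τ z := by
  have e : latPt τ (0, 1) = τ := by simp [latPt]
  have h1 := P3_shift τ z (0, 1)
  have h2 := P4_shift τ z (0, 1)
  have h3 := DD_shift τ hτ z hz (0, 1)
  rw [e] at h1 h2 h3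
  unfold FF
  rw [h1, h2, h3, wp_add_tau τ hτ z hz, zeta1_add_tau τ hτ z hz]
  push_cast
  ring

lemma FF_neg (τ : ℂ) (hτ : 0 < τ.im) (z : ℂ) (hz : ¬ lat τ z) :
    FF τ (-z) = - FF τ z := by
  unfold FF zeta1
  rw [P3_neg, P4_neg, DD_neg, wp_neg τ hτ z hz, wzeta_neg τ hτ z hz]
  ring

lemma FF_diff (τ : ℂ) (hτ : 0 < τ.im) (z : ℂ) (hz : ¬ lat τ z) :
    DifferentiableAt ℂ (FF τ) z := by
  have h1 := differentiableAt_DD τ hτ z hz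
  have h2 := differentiableAt_P4 τ hτ z hz
  have h3 := (hasDerivAt_P3 τ hτ z hz).differentiableAt
  have h4 := (hasDerivAt_wp τ hτ z hz).differentiableAt
  have h5 := (hasDerivAt_wzeta τ hτ z hz).differentiableAt
  unfold FF zeta1
  fun_prop

/-- regular part of zeta at the origin (divided by the cube) -/
def BB (t z : ℂ) : ℂ := ∑' p : ℤ × ℤ, 1 / ((latPt t p) ^ 3 * (z - latPt t p))

lemma lower_zero (t : ℂ) (ht : 0 < t.im) : ∃ c > 0,
    ∀ p, p ≠ 0 → ∀ w ∈ Metric.ball (0 : ℂ) c, c * hNrm p ≤ ‖w - latPt t p‖ := by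
  obtain ⟨c, hc, h⟩ := key_lower t ht 0 {p | p ≠ 0}
    (fun p hp => by simpa using latPt_ne_zero t ht p hp)
  exact ⟨c, hc, fun p hp w hw => h w t (by rwa [← dist_eq_norm]) (by simpa using hc) p hp⟩

lemma BB_bound {c : ℝ} (hc : 0 < c) (p : ℤ × ℤ) {w o : ℂ}
    (hw : c * hNrm p ≤ ‖w - o‖) (ho : c * hNrm p ≤ ‖o‖) :
    ‖1 / (o ^ 3 * (w - o))‖ ≤ (c⁻¹) ^ 4 * ((hNrm p) ^ 3)⁻¹ := by
  have hp := hNrm_pos p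
  have hp1 := hNrm_one_le p
  have h1 : ‖(w - o)⁻¹‖ ≤ c⁻¹ := by
    refine (inv_bound hc hp hw).trans ?_
    have : (hNrm p)⁻¹ ≤ 1 := inv_le_one_of_one_le₀ hp1
    have : 0 < c⁻¹ := by positivity
    nlinarith
  have h2 := pow_three_bound hc p ho
  have e : 1 / (o ^ 3 * (w - o)) = (1 / o ^ 3) * (w - o)⁻¹ := by
    rw [one_div, mul_inv, one_div]
  rw [e, norm_mul]
  calc _ ≤ ((c⁻¹) ^ 3 * ((hNrm p) ^ 3)⁻¹) * c⁻¹ := by gcongr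
    _ = _ := by ring

lemma BB_terms (t : ℂ) {c : ℝ} (hc : 0 < c)
    (h : ∀ p, p ≠ 0 → ∀ w ∈ Metric.ball (0 : ℂ) c, c * hNrm p ≤ ‖w - latPt t p‖) (p : ℤ × ℤ) (w : ℂ)
    (hw : w ∈ Metric.ball (0 : ℂ) c) :
    ‖1 / ((latPt t p) ^ 3 * (w - latPt t p))‖ ≤ (c⁻¹) ^ 4 * ((hNrm p) ^ 3)⁻¹ := by
  by_cases hp : p = 0
  · subst hp
    have := hNrm_pos 0
    simp only [latPt_zero]
    simp
    positivity
  · refine BB_bound hc p (h p hp w hw) ?_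
    have := h p hp 0 (Metric.mem_ball_self hc)
    simpa using this

lemma BB_diffOn (t : ℂ) {c : ℝ} (hc : 0 < c)
    (h : ∀ p, p ≠ 0 → ∀ w ∈ Metric.ball (0 : ℂ) c, c * hNrm p ≤ ‖w - latPt t p‖) :
    DifferentiableOn ℂ (BB t) (Metric.ball 0 c) := by
  refine Complex.differentiableOn_tsum_of_summable_norm (u := fun p => (c⁻¹) ^ 4 * ((hNrm p) ^ 3)⁻¹)
    (summable_hNrm.mul_left _) (fun p => ?_) Metric.isOpen_ball
    (fun p w hw => BB_terms t hc h p w hw)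
  by_cases hp : p = 0
  · subst hp
    simp only [latPt_zero]
    simp
  · intro w hw
    have h1 := ne_of_lower hc (h p hp w hw)
    have h0 := h p hp 0 (Metric.mem_ball_self hc)
    have h2 : latPt t p ≠ 0 := by
      have := ne_of_lower hc h0
      simpa using this
    have h3 : (latPt t p) ^ 3 * (w - latPt t p) ≠ 0 := mul_ne_zero (pow_ne_zero _ h2) h1
    fun_prop (disch := exact h3)

lemma cube_sum (t : ℂ) : ∑' p : ℤ × ℤ, 1 / (latPt t p) ^ 3 = 0 := by
  have h : ∑' p : ℤ × ℤ, 1 / (latPt t p) ^ 3 = - ∑' p : ℤ × ℤ, 1 / (latPt t p) ^ 3 := by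
    nth_rewrite 1 [← (Equiv.neg (ℤ × ℤ)).tsum_eq (fun p => 1 / (latPt t p) ^ 3)]
    rw [← tsum_neg]
    refine tsum_congr fun p => ?_
    rw [Equiv.neg_apply, latPt_neg, Odd.neg_pow (by decide), div_neg]
  linear_combination h / 2

lemma not_lat_of_ball (t : ℂ) {c : ℝ} (hc : 0 < c)
    (h : ∀ p, p ≠ 0 → ∀ w ∈ Metric.ball (0 : ℂ) c, c * hNrm p ≤ ‖w - latPt t p‖) (z : ℂ)
    (hz : z ∈ Metric.ball (0 : ℂ) c) (hz0 : z ≠ 0) : ¬ lat t z := by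
  rintro ⟨m, n, e⟩
  have e' : z = latPt t (m, n) := e
  by_cases hp : ((m, n) : ℤ × ℤ) = 0
  · rw [hp, latPt_zero] at e'
    exact hz0 e'
  · have := ne_of_lower hc (h _ hp z hz)
    rw [e'] at this
    simp at this

lemma wzeta_near (t : ℂ) (ht : 0 < t.im) {c : ℝ} (hc : 0 < c)
    (h : ∀ p, p ≠ 0 → ∀ w ∈ Metric.ball (0 : ℂ) c, c * hNrm p ≤ ‖w - latPt t p‖) (z : ℂ)
    (hz : z ∈ Metric.ball (0 : ℂ) c) (hz0 : z ≠ 0) :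
    wzeta t z = 1 / z + z ^ 3 * BB t z := by
  have hl := not_lat_of_ball t hc h z hz hz0
  rw [wzeta_eq t ht z hl]
  have s1 : Summable (fun p : ℤ × ℤ => 1 / ((latPt t p) ^ 3 * (z - latPt t p))) :=
    summable_of_bound _ _ (fun p => BB_terms t hc h p z hz)
  have s2 : Summable (fun p : ℤ × ℤ => 1 / (latPt t p) ^ 3) := by
    refine summable_of_bound _ (c⁻¹ ^ 3) (fun p => ?_)
    by_cases hp : p = 0
    · subst hp
      have := hNrm_pos 0
      simp only [latPt_zero]
      simp
      positivity
    · refine pow_three_bound hc p ?_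
      have := h p hp 0 (Metric.mem_ball_self hc)
      simpa using this
  have s3 : HasSum (fun p : ℤ × ℤ => if p = 0 then 1 / z else 0) (1 / z) := hasSum_ite_eq 0 _
  have s4 := (s3.add (s1.hasSum.mul_left (z ^ 3))).add (s2.hasSum.mul_left (-z ^ 2))
  rw [cube_sum, mul_zero, add_zero] at s4
  unfold BB
  rw [← s4.tsum_eq]
  refine tsum_congr fun p => ?_
  by_cases hp : p = 0
  · subst hp
    simp [fT, latPt_zero]
  · have h1 := sub_latPt_ne t z hl p
    have h2 := latPt_ne_zero t ht p hp
    simp only [fT, hp, if_false, zero_add]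
    field_simp
    ring

end

section

open Filter Topology

/-- candidate for the holomorphic extension of the defect at the origin -/
def HH (τ z : ℂ) : ℂ :=
  let b0 := BB τ z
  let b1 := deriv (BB τ) z
  let b2 := deriv (deriv (BB τ)) z
  let b3 := deriv (deriv (deriv (BB τ))) z
  let A0 := z ^ 3 * b0
  let A1 := 3 * z ^ 2 * b0 + z ^ 3 * b1
  let A2 := 6 * z * b0 + 6 * z ^ 2 * b1 + z ^ 3 * b2
  let A3 := 6 * b0 + 18 * z * b1 + 9 * z ^ 2 * b2 + z ^ 3 * b3
  i2pi⁻¹ * (A0 * A3 - eta1 τ * z * A3 - 3 * A1 * A2 - 3 * eta1 τ * A2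
    + 30 * b1 + 12 * z * b2 + z ^ 2 * b3) - 6 * DD τ z

lemma BB_derivs (τ : ℂ) {c : ℝ} (hc : 0 < c)
    (h : ∀ p, p ≠ 0 → ∀ w ∈ Metric.ball (0 : ℂ) c, c * hNrm p ≤ ‖w - latPt τ p‖) (z : ℂ)
    (hz : z ∈ Metric.ball (0 : ℂ) c) :
    DifferentiableAt ℂ (BB τ) z ∧ DifferentiableAt ℂ (deriv (BB τ)) z ∧
    DifferentiableAt ℂ (deriv (deriv (BB τ))) z ∧
    DifferentiableAt ℂ (deriv (deriv (deriv (BB τ)))) z := by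
  have h0 := BB_diffOn τ hc h
  have h1 := h0.deriv Metric.isOpen_ball
  have h2 := h1.deriv Metric.isOpen_ball
  have h3 := h2.deriv Metric.isOpen_ball
  have hn := Metric.isOpen_ball.mem_nhds hz
  exact ⟨h0.differentiableAt hn, h1.differentiableAt hn, h2.differentiableAt hn,
    h3.differentiableAt hn⟩

lemma HH_diff (τ : ℂ) (hτ : 0 < τ.im) : DifferentiableAt ℂ (HH τ) 0 := by
  obtain ⟨c, hc, h⟩ := lower_zero τ hτ
  obtain ⟨h0, h1, h2, h3⟩ := BB_derivs τ hc h 0 (Metric.mem_ball_self hc)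
  have h4 := differentiableAt_DD_zero τ hτ
  unfold HH
  fun_prop

lemma FF_near (τ : ℂ) (hτ : 0 < τ.im) {c : ℝ} (hc : 0 < c)
    (h : ∀ p, p ≠ 0 → ∀ w ∈ Metric.ball (0 : ℂ) c, c * hNrm p ≤ ‖w - latPt τ p‖) (z : ℂ)
    (hz : z ∈ Metric.ball (0 : ℂ) c) (hz0 : z ≠ 0) : FF τ z = HH τ z := by
  have near : ∀ w ∈ Metric.ball (0 : ℂ) c, w ≠ 0 →
      ∀ᶠ x in 𝓝 w, x ∈ Metric.ball (0 : ℂ) c ∧ x ≠ 0 := fun w hw hw0 =>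
    (Metric.isOpen_ball.mem_nhds hw |> fun h => h : ∀ᶠ x in 𝓝 w, x ∈ Metric.ball (0 : ℂ) c).and
      (isOpen_ne.mem_nhds hw0)
  have e1 : ∀ w ∈ Metric.ball (0 : ℂ) c, w ≠ 0 →
      wp τ w = 1 / w ^ 2 - (3 * w ^ 2 * BB τ w + w ^ 3 * deriv (BB τ) w) := by
    intro w hw hw0
    obtain ⟨d0, d1, d2, d3⟩ := BB_derivs τ hc h w hw
    have a := hasDerivAt_wzeta τ hτ w (not_lat_of_ball τ hc h w hw hw0)
    have b := (hasDerivAt_inv_pow 0 w 1 (by simpa using hw0)).add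
      ((hasDerivAt_pow 3 w).mul d0.hasDerivAt)
    have a' := a.congr_of_eventuallyEq (f₁ := fun x => 1 / (x - 0) ^ 1 + x ^ 3 * BB τ x) (by
      filter_upwards [near w hw hw0] with x hx
      rw [wzeta_near τ hτ hc h x hx.1 hx.2, sub_zero, pow_one])
    have u := a'.unique b
    simp only [sub_zero] at u
    push_cast at u
    linear_combination -u
  have e2 : ∀ w ∈ Metric.ball (0 : ℂ) c, w ≠ 0 →
      -2 * P3 τ w = -2 / w ^ 3 - (6 * w * BB τ w + 6 * w ^ 2 * deriv (BB τ) w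
        + w ^ 3 * deriv (deriv (BB τ)) w) := by
    intro w hw hw0
    obtain ⟨d0, d1, d2, d3⟩ := BB_derivs τ hc h w hw
    have a := hasDerivAt_wp τ hτ w (not_lat_of_ball τ hc h w hw hw0)
    have b := (hasDerivAt_inv_pow 0 w 2 (by simpa using hw0)).sub
      ((((hasDerivAt_pow 2 w).const_mul 3).mul d0.hasDerivAt).add
        ((hasDerivAt_pow 3 w).mul d1.hasDerivAt))
    have a' := a.congr_of_eventuallyEq (f₁ := fun x => 1 / (x - 0) ^ 2 -
        (3 * x ^ 2 * BB τ x + x ^ 3 * deriv (BB τ) x)) (by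
      filter_upwards [near w hw hw0] with x hx
      rw [e1 x hx.1 hx.2, sub_zero])
    have u := a'.unique b
    simp only [sub_zero] at u
    push_cast at u
    linear_combination u
  have e3 : ∀ w ∈ Metric.ball (0 : ℂ) c, w ≠ 0 →
      6 * P4 τ w = 6 / w ^ 4 - (6 * BB τ w + 18 * w * deriv (BB τ) w
        + 9 * w ^ 2 * deriv (deriv (BB τ)) w + w ^ 3 * deriv (deriv (deriv (BB τ))) w) := by
    intro w hw hw0
    obtain ⟨d0, d1, d2, d3⟩ := BB_derivs τ hc h w hw
    have a := (hasDerivAt_P3 τ hτ w (not_lat_of_ball τ hc h w hw hw0)).const_mul (-2)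
    have b := ((hasDerivAt_inv_pow 0 w 3 (by simpa using hw0)).const_mul (-2)).sub
      (((((hasDerivAt_pow 1 w).const_mul 6).mul d0.hasDerivAt).add
        (((hasDerivAt_pow 2 w).const_mul 6).mul d1.hasDerivAt)).add
        ((hasDerivAt_pow 3 w).mul d2.hasDerivAt))
    have a' := a.congr_of_eventuallyEq (f₁ := fun x => -2 * (1 / (x - 0) ^ 3) -
        (6 * x ^ 1 * BB τ x + 6 * x ^ 2 * deriv (BB τ) x + x ^ 3 * deriv (deriv (BB τ)) x)) (by
      filter_upwards [near w hw hw0] with x hx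
      rw [e2 x hx.1 hx.2, sub_zero, pow_one]
      ring)
    have u := a'.unique b
    simp only [sub_zero] at u
    push_cast at u
    linear_combination u
  have hi := i2pi_ne
  have w0 := wzeta_near τ hτ hc h z hz hz0
  unfold FF HH zeta1
  rw [e3 z hz hz0, e2 z hz hz0, e1 z hz hz0, w0]
  field_simp
  ring

lemma lat_add_one_iff (τ z : ℂ) : lat τ (z + 1) ↔ lat τ z := by
  refine ⟨fun h => by_contra fun h' => lat_add_one τ z h' h, ?_⟩
  rintro ⟨m, n, h⟩
  exact ⟨m + 1, n, by push_cast; linear_combination h⟩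

lemma lat_add_tau_iff (τ z : ℂ) : lat τ (z + τ) ↔ lat τ z := by
  refine ⟨fun h => by_contra fun h' => lat_add_tau τ z h' h, ?_⟩
  rintro ⟨m, n, h⟩
  exact ⟨m, n + 1, by push_cast; linear_combination h⟩

open Classical in
/-- the entire extension of the defect -/
def F1 (τ z : ℂ) : ℂ := if lat τ z then HH τ 0 else FF τ z

lemma F1_add_one (τ : ℂ) (hτ : 0 < τ.im) (z : ℂ) : F1 τ (z + 1) = F1 τ z := by
  unfold F1
  by_cases h : lat τ z
  · rw [if_pos h, if_pos ((lat_add_one_iff τ z).mpr h)]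
  · rw [if_neg h, if_neg (lat_add_one τ z h), FF_add_one τ hτ z h]

lemma F1_add_tau (τ : ℂ) (hτ : 0 < τ.im) (z : ℂ) : F1 τ (z + τ) = F1 τ z := by
  unfold F1
  by_cases h : lat τ z
  · rw [if_pos h, if_pos ((lat_add_tau_iff τ z).mpr h)]
  · rw [if_neg h, if_neg (lat_add_tau τ z h), FF_add_tau τ hτ z h]

lemma F1_period (τ : ℂ) (hτ : 0 < τ.im) (m n : ℤ) (z : ℂ) : F1 τ (z + (m + n * τ)) = F1 τ z := by
  have p1 : Function.Periodic (F1 τ) 1 := F1_add_one τ hτ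
  have p2 : Function.Periodic (F1 τ) τ := F1_add_tau τ hτ
  have h1 := p1.int_mul m z
  have h2 := p2.int_mul n (z + m)
  rw [mul_one] at h1
  rw [← add_assoc, h2, h1]

lemma F1_diff_zero (τ : ℂ) (hτ : 0 < τ.im) : DifferentiableAt ℂ (F1 τ) 0 := by
  obtain ⟨c, hc, h⟩ := lower_zero τ hτ
  refine (HH_diff τ hτ).congr_of_eventuallyEq ?_
  filter_upwards [Metric.ball_mem_nhds (0 : ℂ) hc] with z hz
  unfold F1
  by_cases hz0 : z = 0
  · subst hz0
    rw [if_pos ⟨0, 0, by simp⟩]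
  · rw [if_neg (not_lat_of_ball τ hc h z hz hz0), FF_near τ hτ hc h z hz hz0]

lemma F1_diff (τ : ℂ) (hτ : 0 < τ.im) : Differentiable ℂ (F1 τ) := by
  intro z
  by_cases hz : lat τ z
  · obtain ⟨m, n, e⟩ := hz
    have h0 : DifferentiableAt ℂ (F1 τ) (z - (m + n * τ)) := by
      rw [e, sub_self]
      exact F1_diff_zero τ hτ
    have h1 : DifferentiableAt ℂ (fun w => F1 τ (w - (m + n * τ))) z :=
      h0.comp z (differentiableAt_id.sub_const _)
    have h2 : (fun w => F1 τ (w - (m + n * τ))) = F1 τ := by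
      ext w
      have := F1_period τ hτ m n (w - (m + n * τ))
      rw [sub_add_cancel] at this
      exact this.symm
    rwa [h2] at h1
  · refine (FF_diff τ hτ z hz).congr_of_eventuallyEq ?_
    filter_upwards [eventually_not_lat τ hτ z hz] with w hw
    unfold F1
    rw [if_neg hw]

lemma F1_bounded (τ : ℂ) (hτ : 0 < τ.im) : Bornology.IsBounded (Set.range (F1 τ)) := by
  have hk : IsCompact ((fun x : ℝ × ℝ => F1 τ ((x.1 : ℂ) + x.2 * τ)) ''
      (Set.Icc 0 1 ×ˢ Set.Icc 0 1)) := by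
    refine (isCompact_Icc.prod isCompact_Icc).image ?_
    have := (F1_diff τ hτ).continuous
    fun_prop
  refine hk.isBounded.subset ?_
  rintro _ ⟨z, rfl⟩
  set y := z.im / τ.im with hy
  set x := z.re - y * τ.re with hx
  have hyz : y * τ.im = z.im := by rw [hy]; field_simp
  have ez : z = (x : ℂ) + y * τ := by
    apply Complex.ext
    · simp [hx]
    · simp [hyz]
  refine ⟨(Int.fract x, Int.fract y), ⟨⟨Int.fract_nonneg _, (Int.fract_lt_one _).le⟩,
    ⟨Int.fract_nonneg _, (Int.fract_lt_one _).le⟩⟩, ?_⟩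
  have h := F1_period τ hτ ⌊x⌋ ⌊y⌋ ((Int.fract x : ℝ) + (Int.fract y : ℝ) * τ)
  show F1 τ ((Int.fract x : ℝ) + (Int.fract y : ℝ) * τ) = _
  rw [← h]
  congr 1
  have fx : ((Int.fract x : ℝ) : ℂ) + ⌊x⌋ = x := by
    exact_mod_cast congrArg (fun r : ℝ => (r : ℂ)) (Int.fract_add_floor x)
  have fy : ((Int.fract y : ℝ) : ℂ) + ⌊y⌋ = y := by
    exact_mod_cast congrArg (fun r : ℝ => (r : ℂ)) (Int.fract_add_floor y)
  rw [ez, ← fx, ← fy]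
  ring

lemma FF_zero (τ : ℂ) (hτ : 0 < τ.im) (z : ℂ) (hz : ¬ lat τ z) : FF τ z = 0 := by
  have h := (F1_diff τ hτ).apply_eq_apply_of_bounded (F1_bounded τ hτ) z (-z)
  unfold F1 at h
  rw [if_neg hz, if_neg (lat_neg τ z hz), FF_neg τ hτ z hz] at h
  linear_combination h / 2

end

/-- `∂_τ ℘' + ζ₁ ℘'' = (2πi)⁻¹ · 3 (℘ + (2πi)² E₂/12) ℘'`. -/
theorem heat_identity_wp' (τ : ℂ) (hτ : 0 < τ.im) (z : ℂ) (hz : ¬ lat τ z) :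
    deriv (fun t => deriv (wp t) z) τ + zeta1 τ z * deriv (deriv (wp τ)) z
      = i2pi⁻¹ * 3 * (wp τ z + i2pi ^ 2 * E2 (Complex.exp (i2pi * τ)) / 12)
          * deriv (wp τ) z := by
  have h := FF_zero τ hτ z hz
  unfold FF at h
  rw [deriv_tau τ hτ z hz, deriv_deriv_wp τ hτ z hz, deriv_wp τ hτ z hz, eta1_E2 τ hτ]
  linear_combination h
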